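/- Let D be a probability distribution over ℝ^d × {±1}, let γ > 0, η ∈ [0,1], and let n be a positive integer. Suppose that an i.i.d. sample of size 2n drawn from the marginal D_X is γ-shattered at the origin with probability at least η. Then there exists a margin-error minimization algorithm A for samples of size n such that E_{S,S̃ ∼ D^n}[ℓ̂(A_γ(S, S̃_X), S̃)] ≥ η/2, where S and S̃ are independent i.i.d. labeled samples of size n from D and S̃_X denotes the unlabeled points of S̃. -/

import Mathlib

open MeasureTheory

/-- Empirical `γ`-margin loss of `w` on a labeled sample `S` of size `n`:
the fraction of examples with `yᵢ ⟨xᵢ, w⟩ ≤ γ`. -/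
noncomputable def empMarginLoss {n d : ℕ} (γ : ℝ) (w : Fin d → ℝ)
    (S : Fin n → (Fin d → ℝ) × ℝ) : ℝ :=
  ((Finset.univ.filter fun i : Fin n => (S i).2 * (∑ j, (S i).1 j * w j) ≤ γ).card : ℝ) / n

/-- `A` is a margin-error minimization algorithm at margin `γ`: on every training
sample `S` and unlabeled test sample `T`, it outputs a vector of norm at most `1`
minimizing the empirical `γ`-margin loss on `S` over the unit ball. -/
def IsMarginErrorMinimizer {n d : ℕ} (γ : ℝ)
    (A : (Fin n → (Fin d → ℝ) × ℝ) → (Fin n → Fin d → ℝ) → (Fin d → ℝ)) : Prop :=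
  ∀ S T, (∑ j, (A S T) j ^ 2 ≤ 1) ∧
    ∀ w : Fin d → ℝ, ∑ j, (w j) ^ 2 ≤ 1 → empMarginLoss γ (A S T) S ≤ empMarginLoss γ w S

/-- A finite sequence of points in `ℝ^d` is `γ`-shattered at the origin. -/
def GammaShatteredAtOrigin {m d : ℕ} (γ : ℝ) (x : Fin m → Fin d → ℝ) : Prop :=
  ∀ y : Fin m → ℝ, (∀ i, y i = 1 ∨ y i = -1) →
    ∃ w : Fin d → ℝ, ∑ j, (w j) ^ 2 ≤ 1 ∧ ∀ i, γ ≤ y i * ∑ j, w j * x i j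

/-- Strict separation from shattering. -/
lemma shat_strict {n d m : ℕ} (hn : 0 < n) {γ : ℝ} (hγ : 0 < γ) (e : Fin m ≃ Fin n ⊕ Fin n)
    (x : Fin m → Fin d → ℝ) (hx : GammaShatteredAtOrigin γ x)
    (y : Fin n → ℝ) (hy : ∀ i, y i = 1 ∨ y i = -1) (σ : ℝ) (hσ : σ = 1 ∨ σ = -1) :
    ∃ w : Fin d → ℝ, ∑ j, (w j) ^ 2 ≤ 1 ∧
      (∀ i, γ < y i * ∑ j, x (e.symm (Sum.inl i)) j * w j) ∧
      (∀ i, 0 < σ * ∑ j, x (e.symm (Sum.inr i)) j * w j) := by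
  obtain ⟨w1, h1, h1'⟩ := hx (fun i => Sum.elim y (fun _ => σ) (e i)) (by
    intro i
    cases h : e i with
    | inl a => simpa [h] using hy a
    | inr a => simpa [h] using hσ)
  obtain ⟨w2, h2, h2'⟩ := hx (fun i => Sum.elim y (fun _ => -σ) (e i)) (by
    intro i
    cases h : e i with
    | inl a => simpa [h] using hy a
    | inr a => rcases hσ with rfl | rfl <;> simp)
  have a1 : ∀ i, γ ≤ y i * ∑ j, x (e.symm (Sum.inl i)) j * w1 j := fun i => by
    simpa [mul_comm] using h1' (e.symm (Sum.inl i))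
  have a2 : ∀ i, γ ≤ y i * ∑ j, x (e.symm (Sum.inl i)) j * w2 j := fun i => by
    simpa [mul_comm] using h2' (e.symm (Sum.inl i))
  have b1 : ∀ i, γ ≤ σ * ∑ j, x (e.symm (Sum.inr i)) j * w1 j := fun i => by
    simpa [mul_comm] using h1' (e.symm (Sum.inr i))
  have b2 : ∀ i, γ ≤ -σ * ∑ j, x (e.symm (Sum.inr i)) j * w2 j := fun i => by
    simpa [mul_comm] using h2' (e.symm (Sum.inr i))
  have hne : w1 ≠ w2 := by
    rintro rfl
    have := b1 ⟨0, hn⟩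
    have := b2 ⟨0, hn⟩
    linarith
  obtain ⟨δ, hδdef⟩ : ∃ δ, δ = ∑ j, (w1 j - w2 j) ^ 2 := ⟨_, rfl⟩
  have hδ : 0 < δ := by
    obtain ⟨j, hj⟩ := Function.ne_iff.1 hne
    rw [hδdef]
    refine Finset.sum_pos' (fun _ _ => sq_nonneg _) ⟨j, Finset.mem_univ _, ?_⟩
    have : w1 j - w2 j ≠ 0 := sub_ne_zero.2 hj
    positivity
  obtain ⟨M, hM⟩ : ∃ M, M = ∑ i, |σ * ∑ j, x (e.symm (Sum.inr i)) j * w2 j| := ⟨_, rfl⟩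
  have hMi : ∀ i, -M ≤ σ * ∑ j, x (e.symm (Sum.inr i)) j * w2 j := by
    intro i
    have h : |σ * ∑ j, x (e.symm (Sum.inr i)) j * w2 j| ≤ M := by
      rw [hM]
      exact Finset.single_le_sum
        (f := fun i => |σ * ∑ j, x (e.symm (Sum.inr i)) j * w2 j|)
        (fun _ _ => abs_nonneg _) (Finset.mem_univ i)
    exact (abs_le.1 h).1
  have hM0 : 0 ≤ M := by rw [hM]; exact Finset.sum_nonneg fun _ _ => abs_nonneg _
  obtain ⟨t, ht⟩ : ∃ t, t = γ / (M + 2 * γ) := ⟨_, rfl⟩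
  have hden : 0 < M + 2 * γ := by linarith
  have ht0 : 0 < t := by rw [ht]; positivity
  have htm : t * (M + 2 * γ) = γ := by rw [ht]; field_simp
  have ht1 : t < 1 := by rw [ht, div_lt_one hden]; linarith
  obtain ⟨a, ha⟩ : ∃ a, a = t * (1 - t) * δ := ⟨_, rfl⟩
  have ha0 : 0 < a := by
    rw [ha]; have : 0 < 1 - t := by linarith
    positivity
  have hlin : ∀ u : Fin d → ℝ, ∑ j, u j * ((1 + a / 2) * ((1 - t) * w1 j + t * w2 j))
      = (1 + a / 2) * ((1 - t) * ∑ j, u j * w1 j + t * ∑ j, u j * w2 j) := by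
    intro u
    simp only [Finset.mul_sum, ← Finset.sum_add_distrib]
    refine Finset.sum_congr rfl fun j _ => ?_
    ring
  refine ⟨fun j => (1 + a / 2) * ((1 - t) * w1 j + t * w2 j), ?_, fun i => ?_, fun i => ?_⟩
  · have h : ∑ j, ((1 + a / 2) * ((1 - t) * w1 j + t * w2 j)) ^ 2
        = (1 + a / 2) ^ 2 * ((1 - t) * ∑ j, w1 j ^ 2 + t * ∑ j, w2 j ^ 2 - a) := by
      rw [ha, hδdef]
      simp only [Finset.mul_sum, ← Finset.sum_add_distrib, ← Finset.sum_sub_distrib]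
      refine Finset.sum_congr rfl fun j _ => ?_
      ring
    rw [h]
    have h3 : (1 - t) * ∑ j, w1 j ^ 2 + t * ∑ j, w2 j ^ 2 - a ≤ 1 - a := by
      nlinarith
    calc _ ≤ (1 + a / 2) ^ 2 * (1 - a) := by gcongr
      _ ≤ 1 := by nlinarith [pow_pos ha0 3, pow_pos ha0 2]
  · rw [hlin]
    have h3 : γ ≤ (1 - t) * (y i * ∑ j, x (e.symm (Sum.inl i)) j * w1 j)
        + t * (y i * ∑ j, x (e.symm (Sum.inl i)) j * w2 j) := by nlinarith [a1 i, a2 i]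
    nlinarith [mul_pos ha0 hγ]
  · rw [hlin]
    have h3 : 0 < (1 - t) * (σ * ∑ j, x (e.symm (Sum.inr i)) j * w1 j)
        + t * (σ * ∑ j, x (e.symm (Sum.inr i)) j * w2 j) := by nlinarith [b1 i, hMi i]
    have : 0 < 1 + a / 2 := by linarith
    nlinarith [mul_pos this h3]

lemma loss_meas_comp {α : Type*} [MeasurableSpace α] {n d : ℕ} (γ : ℝ)
    (f : α → Fin d → ℝ) (g : α → Fin n → (Fin d → ℝ) × ℝ) (hf : Measurable f) (hg : Measurable g) :
    Measurable fun a => empMarginLoss γ (f a) (g a) := by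
  unfold empMarginLoss
  simp only [Finset.card_filter, Nat.cast_sum]
  refine Measurable.div_const (Finset.measurable_sum _ fun i _ => ?_) _
  refine (measurable_of_countable (fun k : ℕ => (k : ℝ))).comp ?_
  refine Measurable.ite (measurableSet_le ?_ measurable_const) measurable_const measurable_const
  fun_prop

lemma loss_nonneg {n d : ℕ} (γ : ℝ) (w : Fin d → ℝ) (S : Fin n → (Fin d → ℝ) × ℝ) :
    0 ≤ empMarginLoss γ w S := by unfold empMarginLoss; positivity

lemma loss_le_one {n d : ℕ} (γ : ℝ) (w : Fin d → ℝ) (S : Fin n → (Fin d → ℝ) × ℝ) :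
    empMarginLoss γ w S ≤ 1 := by
  unfold empMarginLoss
  refine div_le_one_of_le₀ ?_ (by positivity)
  exact_mod_cast (Finset.card_le_univ _).trans (by simp)

lemma loss_mono {n d : ℕ} (γ : ℝ) (w w' : Fin d → ℝ) (S : Fin n → (Fin d → ℝ) × ℝ)
    (h : ∀ i, γ < (S i).2 * (∑ j, (S i).1 j * w j) → γ < (S i).2 * (∑ j, (S i).1 j * w' j)) :
    empMarginLoss γ w' S ≤ empMarginLoss γ w S := by
  unfold empMarginLoss
  refine div_le_div_of_nonneg_right ?_ (Nat.cast_nonneg _)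
  refine Nat.cast_le.2 (Finset.card_le_card fun i => ?_)
  simp only [Finset.mem_filter, Finset.mem_univ, true_and]
  intro h1
  by_contra h2
  exact absurd (h i (not_le.1 h2)) (not_lt.2 h1)

/-- the unit ball -/
abbrev UBall (d : ℕ) := {w : Fin d → ℝ // ∑ j, (w j) ^ 2 ≤ 1}

instance uBallNonempty (d : ℕ) : Nonempty (UBall d) := ⟨⟨0, by simp⟩⟩

noncomputable def wseq (d : ℕ) (k : ℕ) : Fin d → ℝ :=
  (TopologicalSpace.denseSeq (UBall d) k).1

lemma wseq_ball (d k : ℕ) : ∑ j, (wseq d k j) ^ 2 ≤ 1 :=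
  (TopologicalSpace.denseSeq (UBall d) k).2

lemma wseq_dense {d : ℕ} (U : Set (Fin d → ℝ)) (hU : IsOpen U) (w : Fin d → ℝ)
    (hw : ∑ j, (w j) ^ 2 ≤ 1) (hwU : w ∈ U) : ∃ k, wseq d k ∈ U := by
  obtain ⟨_, h, k, rfl⟩ := (TopologicalSpace.denseRange_denseSeq (UBall d)).exists_mem_open
    (hU.preimage continuous_subtype_val) ⟨⟨w, hw⟩, hwU⟩ |>.imp
      (fun k h => (⟨_, h, k, rfl⟩ : ∃ z : UBall d, z ∈ Subtype.val ⁻¹' U ∧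
        ∃ k, TopologicalSpace.denseSeq (UBall d) k = z)) |>.choose_spec
  exact ⟨k, h⟩

lemma open_pos {n d : ℕ} (c : ℝ) (y : Fin n → ℝ) (x : Fin n → Fin d → ℝ) (I : Set (Fin n)) :
    IsOpen {w : Fin d → ℝ | ∀ i ∈ I, c < y i * ∑ j, x i j * w j} := by
  have : {w : Fin d → ℝ | ∀ i ∈ I, c < y i * ∑ j, x i j * w j}
      = ⋂ i ∈ I, {w : Fin d → ℝ | c < y i * ∑ j, x i j * w j} := by ext; simp
  rw [this]
  refine I.toFinite.isOpen_biInter fun i _ => isOpen_lt continuous_const (by fun_prop)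

/-- `wseq d k` minimizes the margin loss among the dense sequence. -/
def IsMinK {n d : ℕ} (γ : ℝ) (S : Fin n → (Fin d → ℝ) × ℝ) (k : ℕ) : Prop :=
  ∀ l, empMarginLoss γ (wseq d k) S ≤ empMarginLoss γ (wseq d l) S

def PosK {n d : ℕ} (σ : ℝ) (T : Fin n → Fin d → ℝ) (k : ℕ) : Prop :=
  ∀ i, 0 < σ * ∑ j, T i j * wseq d k j

def Sel {n d : ℕ} (γ σ : ℝ) (p : (Fin n → (Fin d → ℝ) × ℝ) × (Fin n → Fin d → ℝ)) (k : ℕ) : Prop :=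
  IsMinK γ p.1 k ∧ (PosK σ p.2 k ∨ ¬ ∃ l, IsMinK γ p.1 l ∧ PosK σ p.2 l)

lemma exists_minK {n d : ℕ} (γ : ℝ) (S : Fin n → (Fin d → ℝ) × ℝ) : ∃ k, IsMinK γ S k := by
  let f : ℕ → ℕ := fun k =>
    (Finset.univ.filter fun i : Fin n => (S i).2 * (∑ j, (S i).1 j * wseq d k j) ≤ γ).card
  refine ⟨Function.argmin f, fun l => ?_⟩
  have := Function.argmin_le f l
  unfold empMarginLoss
  gcongr

lemma exists_sel {n d : ℕ} (γ σ : ℝ) (p : (Fin n → (Fin d → ℝ) × ℝ) × (Fin n → Fin d → ℝ)) :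
    ∃ k, Sel γ σ p k := by
  by_cases h : ∃ l, IsMinK γ p.1 l ∧ PosK σ p.2 l
  · obtain ⟨l, h1, h2⟩ := h
    exact ⟨l, h1, Or.inl h2⟩
  · obtain ⟨k, hk⟩ := exists_minK (d := d) γ p.1
    exact ⟨k, hk, Or.inr h⟩

lemma meas_sel {n d : ℕ} (γ σ : ℝ) (k : ℕ) :
    MeasurableSet {p : (Fin n → (Fin d → ℝ) × ℝ) × (Fin n → Fin d → ℝ) | Sel γ σ p k} := by
  have h1 : ∀ k, MeasurableSet
      {p : (Fin n → (Fin d → ℝ) × ℝ) × (Fin n → Fin d → ℝ) | IsMinK γ p.1 k} := by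
    intro k
    have : {p : (Fin n → (Fin d → ℝ) × ℝ) × (Fin n → Fin d → ℝ) | IsMinK γ p.1 k} =
        ⋂ l, {p | empMarginLoss γ (wseq d k) p.1 ≤ empMarginLoss γ (wseq d l) p.1} := by
      ext p; simp [IsMinK]
    rw [this]
    refine MeasurableSet.iInter fun l => measurableSet_le ?_ ?_
    · exact loss_meas_comp γ _ _ measurable_const measurable_fst
    · exact loss_meas_comp γ _ _ measurable_const measurable_fst
  have h2 : ∀ k, MeasurableSet
      {p : (Fin n → (Fin d → ℝ) × ℝ) × (Fin n → Fin d → ℝ) | PosK σ p.2 k} := by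
    intro k
    have : {p : (Fin n → (Fin d → ℝ) × ℝ) × (Fin n → Fin d → ℝ) | PosK σ p.2 k} =
        ⋂ i, {p | 0 < σ * ∑ j, p.2 i j * wseq d k j} := by
      ext p; simp [PosK]
    rw [this]
    refine MeasurableSet.iInter fun i => measurableSet_lt measurable_const ?_
    fun_prop
  have : {p : (Fin n → (Fin d → ℝ) × ℝ) × (Fin n → Fin d → ℝ) | Sel γ σ p k} =
      {p | IsMinK γ p.1 k} ∩ ({p | PosK σ p.2 k} ∪
        (⋃ l, ({p | IsMinK γ p.1 l} ∩ {p | PosK σ p.2 l}))ᶜ) := by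
    ext p; simp [Sel]
  rw [this]
  exact MeasurableSet.inter (h1 k) (MeasurableSet.union (h2 k)
    (MeasurableSet.compl (MeasurableSet.iUnion fun l => MeasurableSet.inter (h1 l) (h2 l))))

open Classical in
noncomputable def selIdx {n d : ℕ} (γ σ : ℝ)
    (p : (Fin n → (Fin d → ℝ) × ℝ) × (Fin n → Fin d → ℝ)) : ℕ :=
  Nat.find (exists_sel γ σ p)

lemma selIdx_meas {n d : ℕ} (γ σ : ℝ) :
    Measurable (selIdx (n := n) (d := d) γ σ) := by
  classical
  exact measurable_find _ (meas_sel γ σ)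

lemma selIdx_spec {n d : ℕ} (γ σ : ℝ)
    (p : (Fin n → (Fin d → ℝ) × ℝ) × (Fin n → Fin d → ℝ)) : Sel γ σ p (selIdx γ σ p) := by
  classical
  exact Nat.find_spec (exists_sel γ σ p)

noncomputable def algA {n d : ℕ} (γ σ : ℝ) (S : Fin n → (Fin d → ℝ) × ℝ)
    (T : Fin n → Fin d → ℝ) : Fin d → ℝ := wseq d (selIdx γ σ (S, T))

lemma algA_min {n d : ℕ} (γ σ : ℝ) : IsMarginErrorMinimizer γ (algA (n := n) (d := d) γ σ) := by
  intro S T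
  refine ⟨wseq_ball _ _, fun w hw => ?_⟩
  obtain ⟨k, hk⟩ := wseq_dense _ (open_pos γ (fun i => (S i).2) (fun i => (S i).1)
    {i | γ < (S i).2 * (∑ j, (S i).1 j * w j)}) w hw (fun i hi => hi)
  exact ((selIdx_spec γ σ (S, T)).1 k).trans (loss_mono _ _ _ _ hk)

lemma algA_pos {n d : ℕ} (γ σ : ℝ) (S : Fin n → (Fin d → ℝ) × ℝ) (T : Fin n → Fin d → ℝ)
    (h : ∃ w : Fin d → ℝ, ∑ j, (w j) ^ 2 ≤ 1 ∧
      (∀ i, γ < (S i).2 * ∑ j, (S i).1 j * w j) ∧ (∀ i, 0 < σ * ∑ j, T i j * w j)) (i : Fin n) :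
    0 < σ * ∑ j, T i j * algA γ σ S T j := by
  obtain ⟨w, hw, h1, h2⟩ := h
  obtain ⟨k, hk1, hk2⟩ := wseq_dense _
    ((open_pos γ (fun i => (S i).2) (fun i => (S i).1) Set.univ).inter
      (open_pos 0 (fun _ => σ) T Set.univ)) w hw ⟨fun i _ => h1 i, fun i _ => h2 i⟩
  rcases (selIdx_spec γ σ (S, T)).2 with h | h
  · exact h i
  · exact absurd ⟨k, fun l => loss_mono _ _ _ _ (fun i _ => hk1 i (Set.mem_univ _)),
      fun i => hk2 i (Set.mem_univ _)⟩ h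

lemma algA_meas {n d : ℕ} (γ σ : ℝ) :
    Measurable fun p : (Fin n → (Fin d → ℝ) × ℝ) × (Fin n → (Fin d → ℝ) × ℝ) =>
      empMarginLoss 0 (algA γ σ p.1 (fun i => (p.2 i).1)) p.2 := by
  refine loss_meas_comp 0 _ _ ?_ measurable_snd
  have h : Measurable fun p : (Fin n → (Fin d → ℝ) × ℝ) × (Fin n → (Fin d → ℝ) × ℝ) =>
      (p.1, fun i => (p.2 i).1) := by fun_prop
  exact (measurable_of_countable (wseq d)).comp ((selIdx_meas γ σ).comp h)

lemma loss_sum {n d : ℕ} (hn : 0 < n) (w w' : Fin d → ℝ) (T : Fin n → (Fin d → ℝ) × ℝ)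
    (hT : ∀ i, (T i).2 = 1 ∨ (T i).2 = -1)
    (h1 : ∀ i, 0 < (1 : ℝ) * ∑ j, (T i).1 j * w j)
    (h2 : ∀ i, 0 < (-1 : ℝ) * ∑ j, (T i).1 j * w' j) :
    1 ≤ empMarginLoss 0 w T + empMarginLoss 0 w' T := by
  unfold empMarginLoss
  have hn' : (0 : ℝ) < n := by exact_mod_cast hn
  rw [← add_div, le_div_iff₀ hn', one_mul]
  norm_cast
  calc n = (Finset.univ : Finset (Fin n)).card := by simp
    _ ≤ _ := Finset.card_le_card (t := (Finset.univ.filter fun i : Fin n =>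
        (T i).2 * (∑ j, (T i).1 j * w j) ≤ 0) ∪ (Finset.univ.filter fun i : Fin n =>
        (T i).2 * (∑ j, (T i).1 j * w' j) ≤ 0)) ?_
    _ ≤ _ := Finset.card_union_le _ _
  intro i _
  simp only [Finset.mem_union, Finset.mem_filter, Finset.mem_univ, true_and]
  rcases hT i with h | h
  · right; rw [h]; linarith [h2 i]
  · left; rw [h]; linarith [h1 i]

def comb {n d m : ℕ} (e : Fin m ≃ Fin n ⊕ Fin n)
    (p : (Fin n → (Fin d → ℝ) × ℝ) × (Fin n → (Fin d → ℝ) × ℝ)) : Fin m → Fin d → ℝ :=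
  fun i => (Sum.elim p.1 p.2 (e i)).1

lemma comb_meas {n d m : ℕ} (e : Fin m ≃ Fin n ⊕ Fin n) : Measurable (comb (d := d) e) := by
  refine measurable_pi_lambda _ fun i => ?_
  unfold comb
  cases e i with
  | inl a => simp only [Sum.elim_inl]; fun_prop
  | inr a => simp only [Sum.elim_inr]; fun_prop

lemma comb_map {n d m : ℕ} (e : Fin m ≃ Fin n ⊕ Fin n)
    (D : Measure ((Fin d → ℝ) × ℝ)) [IsProbabilityMeasure D] :
    (Measure.pi fun _ : Fin m => D.map Prod.fst) =
      ((Measure.pi fun _ : Fin n => D).prod (Measure.pi fun _ : Fin n => D)).map (comb e) := by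
  have hpi0 : SigmaFinite (Measure.pi fun _ : Fin n => D) := inferInstance
  have hpi : SFinite (Measure.pi fun _ : Fin n => D) := inferInstance
  have : IsProbabilityMeasure (D.map Prod.fst) :=
    Measure.isProbabilityMeasure_map measurable_fst.aemeasurable
  refine Measure.pi_eq fun s hs => ?_
  rw [Measure.map_apply (comb_meas e) (MeasurableSet.univ_pi hs)]
  have h : comb (d := d) e ⁻¹' (Set.univ.pi s) =
      (Set.univ.pi fun i => Prod.fst ⁻¹' s (e.symm (Sum.inl i))) ×ˢ
      (Set.univ.pi fun i => Prod.fst ⁻¹' s (e.symm (Sum.inr i))) := by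
    ext p
    simp only [Set.mem_preimage, Set.mem_pi, Set.mem_univ, true_implies, Set.mem_prod, comb]
    rw [← e.symm.forall_congr_right]
    simp [Sum.forall]
  rw [h, Measure.prod_prod (μ := Measure.pi fun _ : Fin n => D)
    (ν := Measure.pi fun _ : Fin n => D), Measure.pi_pi, Measure.pi_pi, ← e.symm.prod_comp, Fintype.prod_sum_type]
  simp only [Measure.map_apply measurable_fst (hs _)]

/-- open event containing the shattered event -/
def Good {n d m : ℕ} (γ : ℝ) (e : Fin m ≃ Fin n ⊕ Fin n) : Set (Fin m → Fin d → ℝ) :=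
  {x | ∀ y ∈ Set.univ.pi (fun _ : Fin n => ({1, -1} : Set ℝ)), ∀ σ ∈ ({1, -1} : Set ℝ),
    ∃ w : Fin d → ℝ, ∑ j, (w j) ^ 2 ≤ 1 ∧
      (∀ i, γ < y i * ∑ j, x (e.symm (Sum.inl i)) j * w j) ∧
      (∀ i, 0 < σ * ∑ j, x (e.symm (Sum.inr i)) j * w j)}

lemma good_open {n d m : ℕ} (γ : ℝ) (e : Fin m ≃ Fin n ⊕ Fin n) :
    IsOpen (Good (d := d) γ e) := by
  have : Good (d := d) γ e = ⋂ y ∈ Set.univ.pi (fun _ : Fin n => ({1, -1} : Set ℝ)),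
      ⋂ σ ∈ ({1, -1} : Set ℝ), ⋃ w : UBall d,
      ((⋂ i, {x | γ < y i * ∑ j, x (e.symm (Sum.inl i)) j * w.1 j}) ∩
      (⋂ i, {x | 0 < σ * ∑ j, x (e.symm (Sum.inr i)) j * w.1 j})) := by
    ext x
    simp only [Good, Set.mem_iInter, Set.mem_iUnion, Set.mem_inter_iff, Set.mem_ofPred_eq,
      Subtype.exists, exists_prop]
  rw [this]
  refine (Set.Finite.pi fun _ => Set.toFinite _).isOpen_biInter ?_
  intro y _
  refine (Set.toFinite _).isOpen_biInter fun σ _ => isOpen_iUnion fun w => ?_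
  refine (isOpen_iInter_of_finite fun i => ?_).inter (isOpen_iInter_of_finite fun i => ?_)
  · exact isOpen_lt continuous_const (by fun_prop)
  · exact isOpen_lt continuous_const (by fun_prop)

/-- If an i.i.d. sample of size `2n` from the marginal `D_X` is
`γ`-shattered at the origin with probability at least `η`, then some margin-error
minimization algorithm has expected test misclassification error at least `η/2`
(training and test samples each of size `n`, drawn i.i.d. from `D`). -/
theorem shattered_implies_not_learned
    (d n : ℕ) (hn : 0 < n) (γ η : ℝ) (hγ : 0 < γ) (hη : η ∈ Set.Icc (0 : ℝ) 1)
    (D : Measure ((Fin d → ℝ) × ℝ)) [IsProbabilityMeasure D]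
    (hlabels : ∀ᵐ p ∂D, p.2 = 1 ∨ p.2 = -1)
    (hshat : ENNReal.ofReal η ≤
      (Measure.pi fun _ : Fin (2 * n) => D.map Prod.fst)
        {x | GammaShatteredAtOrigin γ x}) :
    ∃ A : (Fin n → (Fin d → ℝ) × ℝ) → (Fin n → Fin d → ℝ) → (Fin d → ℝ),
      IsMarginErrorMinimizer γ A ∧
      η / 2 ≤ ∫ p : (Fin n → (Fin d → ℝ) × ℝ) × (Fin n → (Fin d → ℝ) × ℝ),
          empMarginLoss 0 (A p.1 (fun i => (p.2 i).1)) p.2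
          ∂((Measure.pi fun _ : Fin n => D).prod (Measure.pi fun _ : Fin n => D)) := by
  obtain ⟨e⟩ : Nonempty (Fin (2 * n) ≃ Fin n ⊕ Fin n) :=
    Fintype.card_eq.1 (by simp [two_mul])
  set μ := (Measure.pi fun _ : Fin n => D).prod (Measure.pi fun _ : Fin n => D) with hμ
  set f : ℝ → (Fin n → (Fin d → ℝ) × ℝ) × (Fin n → (Fin d → ℝ) × ℝ) → ℝ := fun σ p =>
    empMarginLoss 0 (algA γ σ p.1 (fun i => (p.2 i).1)) p.2 with hf
  have hint : ∀ σ, Integrable (f σ) μ := fun σ =>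
    Integrable.of_bound (algA_meas γ σ).aestronglyMeasurable 1 (Filter.Eventually.of_forall
      fun p => by
        rw [Real.norm_eq_abs, abs_of_nonneg (loss_nonneg _ _ _)]
        exact loss_le_one _ _ _)
  have hG : MeasurableSet (comb (d := d) e ⁻¹' Good γ e) :=
    comb_meas e (good_open γ e).measurableSet
  have hGm : ENNReal.ofReal η ≤ μ (comb (d := d) e ⁻¹' Good γ e) := by
    rw [← Measure.map_apply (comb_meas e) (good_open γ e).measurableSet, hμ, ← comb_map e D]
    refine hshat.trans (measure_mono fun x hx => ?_)
    intro y hy σ hσ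
    exact shat_strict hn hγ e x hx y (fun i => by simpa using hy i (Set.mem_univ _)) σ
      (by simpa using hσ)
  have hlab : ∀ᵐ S ∂(Measure.pi fun _ : Fin n => D), ∀ i, (S i).2 = 1 ∨ (S i).2 = -1 := by
    rw [ae_all_iff]
    intro i
    exact (measurePreserving_eval (fun _ : Fin n => D) i).quasiMeasurePreserving.ae hlabels
  have hl1 : ∀ᵐ p ∂μ, ∀ i, (p.1 i).2 = 1 ∨ (p.1 i).2 = -1 :=
    Measure.quasiMeasurePreserving_fst.ae hlab
  have hl2 : ∀ᵐ p ∂μ, ∀ i, (p.2 i).2 = 1 ∨ (p.2 i).2 = -1 :=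
    Measure.quasiMeasurePreserving_snd.ae hlab
  have hae : (comb (d := d) e ⁻¹' Good γ e).indicator (fun _ => (1 : ℝ)) ≤ᵐ[μ]
      fun p => f 1 p + f (-1) p := by
    filter_upwards [hl1, hl2] with p h1 h2
    by_cases hp : p ∈ comb (d := d) e ⁻¹' Good γ e
    · rw [Set.indicator_of_mem hp]
      have key : ∀ σ ∈ ({1, -1} : Set ℝ), ∃ w : Fin d → ℝ, ∑ j, (w j) ^ 2 ≤ 1 ∧
          (∀ i, γ < (p.1 i).2 * ∑ j, (p.1 i).1 j * w j) ∧
          (∀ i, 0 < σ * ∑ j, (p.2 i).1 j * w j) := by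
        intro σ hσ
        have := hp (fun i => (p.1 i).2) (fun i _ => by simpa using h1 i) σ hσ
        simpa [comb] using this
      exact loss_sum hn _ _ p.2 h2
        (algA_pos γ 1 p.1 (fun i => (p.2 i).1) (key 1 (by simp)))
        (algA_pos γ (-1) p.1 (fun i => (p.2 i).1) (key (-1) (by simp)))
    · rw [Set.indicator_of_notMem hp]
      exact add_nonneg (loss_nonneg _ _ _) (loss_nonneg _ _ _)
  have hsum : η ≤ ∫ p, f 1 p ∂μ + ∫ p, f (-1) p ∂μ := by
    rw [← integral_add (hint 1) (hint (-1))]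
    refine le_trans ?_ (integral_mono_ae ((integrable_const (1 : ℝ)).indicator hG)
      ((hint 1).add (hint (-1))) hae)
    rw [integral_indicator_const _ hG, smul_eq_mul, mul_one]
    exact (ENNReal.ofReal_le_iff_le_toReal (measure_ne_top _ _)).1 hGm
  by_cases h : η / 2 ≤ ∫ p, f 1 p ∂μ
  · exact ⟨algA γ 1, algA_min γ 1, h⟩
  · exact ⟨algA γ (-1), algA_min γ (-1), by
      show η / 2 ≤ ∫ p, f (-1) p ∂μ
      linarith⟩
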